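/- Let n ≥ 2 and let S be a symmetric real n×n matrix (a Ricci-like covariant tensor). The Lorentz orbit of S contains an element of minimal Frobenius norm — i.e., there exists Λ₀ ∈ O(1,n−1) such that ‖Λ₀ᵀSΛ₀‖_F ≤ ‖ΛᵀSΛ‖_F for all Λ ∈ O(1,n−1) — if and only if it is NOT the case that the operator ηS has exactly one null eigendirection; that is, if and only if ¬(there exists a null vector ℓ with Sℓ ∈ ℝ·(ηℓ) such that every null vector ℓ' with Sℓ' ∈ ℝ·(ηℓ') is a scalar multiple of ℓ). -/

import Mathlib

open Matrix

noncomputable section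

/-- The Minkowski metric `η = diag(-1, 1, …, 1)` on `ℝⁿ`. -/
def eta (n : ℕ) : Matrix (Fin n) (Fin n) ℝ :=
  Matrix.diagonal fun i => if i.val = 0 then (-1 : ℝ) else 1

/-- The Lorentz group `O(1,n-1)`: matrices with `Λᵀ η Λ = η`. -/
def IsLorentz {n : ℕ} (Λ : Matrix (Fin n) (Fin n) ℝ) : Prop :=
  Λᵀ * eta n * Λ = eta n

/-- A null vector: nonzero with `vᵀηv = 0`. -/
def IsNull {n : ℕ} (v : Fin n → ℝ) : Prop :=
  v ≠ 0 ∧ v ⬝ᵥ (eta n).mulVec v = 0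

/-- The Frobenius norm of a matrix. -/
def frobNorm {n : ℕ} (A : Matrix (Fin n) (Fin n) ℝ) : ℝ :=
  Real.sqrt (Matrix.trace (A * Aᵀ))


/-- The Minkowski inner product. -/
def ip {n : ℕ} (u v : Fin n → ℝ) : ℝ := u ⬝ᵥ (eta n).mulVec v

lemma ip_eq {m : ℕ} (u v : Fin (m+1) → ℝ) :
    ip u v = - (u 0 * v 0) + ∑ i : Fin m, u i.succ * v i.succ := by
  simp [ip, eta, dotProduct, Matrix.mulVec_diagonal, Fin.sum_univ_succ]

lemma ip_add_left {n : ℕ} (u v w : Fin n → ℝ) : ip (u + v) w = ip u w + ip v w := by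
  simp [ip, add_dotProduct]

lemma ip_add_right {n : ℕ} (u v w : Fin n → ℝ) : ip u (v + w) = ip u v + ip u w := by
  simp [ip, mulVec_add, dotProduct_add]

lemma ip_smul_left {n : ℕ} (c : ℝ) (u v : Fin n → ℝ) : ip (c • u) v = c * ip u v := by
  simp [ip]

lemma ip_smul_right {n : ℕ} (c : ℝ) (u v : Fin n → ℝ) : ip u (c • v) = c * ip u v := by
  simp [ip, mulVec_smul]

lemma eta_transpose (n : ℕ) : (eta n)ᵀ = eta n := by simp [eta]

lemma eta_mul_eta (n : ℕ) : eta n * eta n = 1 := by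
  rw [eta, diagonal_mul_diagonal, ← diagonal_one]
  congr 1
  funext i
  split_ifs <;> simp

lemma ip_comm {n : ℕ} (u v : Fin n → ℝ) : ip u v = ip v u := by
  unfold ip
  rw [dotProduct_mulVec, ← mulVec_transpose, eta_transpose, dotProduct_comm]

lemma ip_orth {m : ℕ} (x v : Fin (m+1) → ℝ) (hx0 : x ≠ 0) (hx : ip x x ≤ 0) (hv : ip x v = 0) :
    0 ≤ ip v v ∧ (ip v v ≤ 0 → ∃ c : ℝ, v = c • x) := by
  have h0 : x 0 ≠ 0 := by
    intro h
    rw [ip_eq, h] at hx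
    have hs : ∑ i : Fin m, x i.succ * x i.succ = 0 :=
      le_antisymm (by simpa using hx) (Finset.sum_nonneg fun i _ => mul_self_nonneg _)
    rw [Finset.sum_eq_zero_iff_of_nonneg (fun i _ => mul_self_nonneg _)] at hs
    apply hx0
    funext i
    refine Fin.cases h (fun j => ?_) i
    simpa using hs j (Finset.mem_univ _)
  set c := v 0 / x 0 with hc
  set z := v + (-c) • x with hz
  have hz0 : z 0 = 0 := by simp [hz, hc, h0]
  have hzz : ip z z = ip v v + c ^ 2 * ip x x := by
    simp only [hz, ip_add_left, ip_add_right, ip_smul_left, ip_smul_right, ip_comm v x, hv]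
    ring
  have hzs : ip z z = ∑ i : Fin m, z i.succ * z i.succ := by rw [ip_eq, hz0]; simp
  have hnn : 0 ≤ ip z z := by
    rw [hzs]; exact Finset.sum_nonneg fun i _ => mul_self_nonneg _
  have hcx : c ^ 2 * ip x x ≤ 0 := mul_nonpos_of_nonneg_of_nonpos (sq_nonneg _) hx
  refine ⟨by linarith, fun hle => ⟨c, ?_⟩⟩
  have hs : ∑ i : Fin m, z i.succ * z i.succ = 0 := by rw [← hzs]; linarith
  rw [Finset.sum_eq_zero_iff_of_nonneg (fun i _ => mul_self_nonneg _)] at hs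
  have hz1 : z = 0 := by
    funext i
    refine Fin.cases hz0 (fun j => ?_) i
    simpa using hs j (Finset.mem_univ _)
  rw [hz] at hz1
  have := eq_neg_of_add_eq_zero_left hz1
  simpa using this

/-- The operator `ηS`. -/
def opT {n : ℕ} (S : Matrix (Fin n) (Fin n) ℝ) (x : Fin n → ℝ) : Fin n → ℝ :=
  (eta n).mulVec (S.mulVec x)

lemma opT_add {n : ℕ} (S : Matrix (Fin n) (Fin n) ℝ) (x y : Fin n → ℝ) :
    opT S (x + y) = opT S x + opT S y := by simp [opT, mulVec_add]

lemma opT_smul {n : ℕ} (S : Matrix (Fin n) (Fin n) ℝ) (c : ℝ) (x : Fin n → ℝ) :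
    opT S (c • x) = c • opT S x := by simp [opT, mulVec_smul]

lemma ip_opT {n : ℕ} (S : Matrix (Fin n) (Fin n) ℝ) (x y : Fin n → ℝ) :
    ip x (opT S y) = x ⬝ᵥ S.mulVec y := by
  simp [ip, opT, mulVec_mulVec, ← Matrix.mul_assoc, eta_mul_eta]

lemma opT_symm {n : ℕ} (S : Matrix (Fin n) (Fin n) ℝ) (hS : Sᵀ = S) (x y : Fin n → ℝ) :
    ip (opT S x) y = ip x (opT S y) := by
  rw [ip_comm, ip_opT, ip_opT, dotProduct_mulVec, ← mulVec_transpose, hS, dotProduct_comm]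

lemma eig_iff {n : ℕ} (S : Matrix (Fin n) (Fin n) ℝ) (l : Fin n → ℝ) (c : ℝ) :
    S.mulVec l = c • ((eta n).mulVec l) ↔ opT S l = c • l := by
  constructor
  · intro h
    simp [opT, h, mulVec_smul, mulVec_mulVec, eta_mul_eta]
  · intro h
    rw [← mulVec_smul, ← h]
    simp [opT, mulVec_mulVec, ← Matrix.mul_assoc, eta_mul_eta]

/-- The reduced objective on the hyperboloid. -/
def hfun {n : ℕ} (S : Matrix (Fin n) (Fin n) ℝ) (x : Fin n → ℝ) : ℝ :=
  ip (opT S x) (opT S x) + (ip x (opT S x)) ^ 2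

/-- The time direction. -/
def e0 (m : ℕ) : Fin (m+1) → ℝ := Pi.single 0 1

lemma one_eq (m : ℕ) : (1 : Matrix (Fin (m+1)) (Fin (m+1)) ℝ)
    = eta (m+1) + (2:ℝ) • vecMulVec (e0 m) (e0 m) := by
  ext i j
  refine Fin.cases ?_ (fun i => ?_) i <;> refine Fin.cases ?_ (fun j => ?_) j <;>
    simp [eta, e0, vecMulVec_apply, Matrix.diagonal_apply, Matrix.one_apply,
      (Fin.succ_ne_zero _).symm] <;> norm_num

lemma lorentz_T {n : ℕ} {L : Matrix (Fin n) (Fin n) ℝ} (hL : IsLorentz L) :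
    L * eta n * Lᵀ = eta n := by
  unfold IsLorentz at hL
  have h1 : (eta n * Lᵀ * eta n) * L = 1 := by
    rw [Matrix.mul_assoc, Matrix.mul_assoc, ← Matrix.mul_assoc Lᵀ, hL, eta_mul_eta]
  have h2 := mul_eq_one_comm.mp h1
  calc L * eta n * Lᵀ = (L * (eta n * Lᵀ * eta n)) * eta n := by
        simp only [Matrix.mul_assoc, eta_mul_eta, Matrix.mul_one]
    _ = eta n := by rw [h2, Matrix.one_mul]

lemma lorentz_P {m : ℕ} {L : Matrix (Fin (m+1)) (Fin (m+1)) ℝ} (hL : IsLorentz L) :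
    L * Lᵀ = eta (m+1) + (2:ℝ) • vecMulVec (L.mulVec (e0 m)) (L.mulVec (e0 m)) := by
  have : L * Lᵀ = L * (eta (m+1) + (2:ℝ) • vecMulVec (e0 m) (e0 m)) * Lᵀ := by
    rw [← one_eq, Matrix.mul_one]
  rw [this, Matrix.mul_add, Matrix.add_mul, lorentz_T hL]
  congr 1
  rw [Matrix.mul_smul, Matrix.smul_mul, mul_vecMulVec, vecMulVec_mul, vecMul_transpose]

lemma trace_vmv {n : ℕ} (A : Matrix (Fin n) (Fin n) ℝ) (x y : Fin n → ℝ) :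
    trace (A * vecMulVec x y) = y ⬝ᵥ A.mulVec x := by
  rw [mul_vecMulVec, trace_vecMulVec, dotProduct_comm]

lemma trace_formula {m : ℕ} (S : Matrix (Fin (m+1)) (Fin (m+1)) ℝ) (hS : Sᵀ = S)
    {L : Matrix (Fin (m+1)) (Fin (m+1)) ℝ} (hL : IsLorentz L) :
    trace ((Lᵀ * S * L) * (Lᵀ * S * L)ᵀ)
      = trace (S * eta (m+1) * S * eta (m+1)) + 4 * hfun S (L.mulVec (e0 m)) := by
  have h1 : trace ((Lᵀ * S * L) * (Lᵀ * S * L)ᵀ) = trace (S * (L * Lᵀ) * S * (L * Lᵀ)) := by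
    rw [transpose_mul, transpose_mul, transpose_transpose, hS]
    simp only [Matrix.mul_assoc]
    rw [trace_mul_comm]
    simp only [Matrix.mul_assoc]
  rw [h1, lorentz_P hL]
  set x := L.mulVec (e0 m)
  have e1 : ip (opT S x) (opT S x) = x ⬝ᵥ (S * eta (m+1) * S).mulVec x := by
    rw [opT_symm S hS, ip_opT]
    simp [opT, mulVec_mulVec, Matrix.mul_assoc]
  have e2 : trace (S * vecMulVec x x * S * eta (m+1)) = x ⬝ᵥ (S * eta (m+1) * S).mulVec x := by
    rw [← trace_vmv, Matrix.mul_assoc, Matrix.mul_assoc, trace_mul_comm]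
    rw [Matrix.mul_assoc, trace_mul_comm]
  have e3 : trace (S * vecMulVec x x * S * vecMulVec x x) = (x ⬝ᵥ S.mulVec x) ^ 2 := by
    rw [trace_vmv, mul_vecMulVec, vecMulVec_mul, vecMulVec_mulVec, dotProduct_smul]
    rw [← dotProduct_mulVec]
    simp [sq]
  simp only [Matrix.mul_add, Matrix.add_mul, Matrix.mul_smul, Matrix.smul_mul, trace_add,
    trace_smul, e2, e3, trace_vmv, hfun, e1, ip_opT, smul_eq_mul]
  ring

lemma ip_lorentz {n : ℕ} {L : Matrix (Fin n) (Fin n) ℝ} (hL : IsLorentz L) (x y : Fin n → ℝ) :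
    ip (L.mulVec x) (L.mulVec y) = ip x y := by
  unfold ip
  have h : (eta n).mulVec y = Lᵀ.mulVec ((eta n).mulVec (L.mulVec y)) := by
    rw [mulVec_mulVec, mulVec_mulVec, hL]
  rw [h, dotProduct_mulVec x, vecMul_transpose]

lemma ip_e0 (m : ℕ) : ip (e0 m) (e0 m) = -1 := by
  rw [ip_eq]; simp [e0]

lemma ip_e0_left {m : ℕ} (x : Fin (m+1) → ℝ) : ip (e0 m) x = - x 0 := by
  rw [ip_eq]; simp [e0]

lemma ip_sum {m : ℕ} (x : Fin (m+1) → ℝ) (hx : ip x x = -1) : 1 ≤ x 0 * x 0 := by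
  rw [ip_eq] at hx
  have : 0 ≤ ∑ i : Fin m, x i.succ * x i.succ := Finset.sum_nonneg fun i _ => mul_self_nonneg _
  linarith

/-- Reflection in the hyperplane orthogonal to `v`. -/
lemma reflection {n : ℕ} (v : Fin n → ℝ) (hv : ip v v ≠ 0) :
    ∃ L : Matrix (Fin n) (Fin n) ℝ, IsLorentz L ∧
      ∀ x, L.mulVec x = x + (-(2 * ip v x / ip v v)) • v := by
  refine ⟨1 + (-(2 / ip v v)) • vecMulVec v ((eta n).mulVec v), ?_, ?_⟩
  · unfold IsLorentz
    have hq : (eta n).mulVec v ⬝ᵥ v = ip v v := by rw [dotProduct_comm]; rfl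
    have hvm : v ᵥ* eta n = (eta n).mulVec v := by rw [← mulVec_transpose, eta_transpose]
    simp only [transpose_add, transpose_one, transpose_smul, transpose_vecMulVec,
      Matrix.add_mul, Matrix.mul_add, Matrix.one_mul, Matrix.mul_one, Matrix.smul_mul,
      Matrix.mul_smul, mul_vecMulVec, vecMulVec_mul, hvm, vecMulVec_mulVec,
      add_mulVec, smul_mulVec]
    ext i j
    simp [vecMulVec_apply, hq]
    field_simp
    ring
  · intro x
    rw [add_mulVec, one_mulVec, smul_mulVec, vecMulVec_mulVec]
    have : (eta n).mulVec v ⬝ᵥ x = ip v x := by rw [dotProduct_comm, ip_comm]; rfl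
    rw [this]
    ext i
    simp
    ring

lemma transitive {m : ℕ} (x : Fin (m+1) → ℝ) (hx : ip x x = -1) :
    ∃ L : Matrix (Fin (m+1)) (Fin (m+1)) ℝ, IsLorentz L ∧
      (L.mulVec (e0 m) = x ∨ L.mulVec (e0 m) = -x) := by
  have key : ∀ y : Fin (m+1) → ℝ, ip y y = -1 → 0 < y 0 →
      ∃ L : Matrix (Fin (m+1)) (Fin (m+1)) ℝ, IsLorentz L ∧ L.mulVec (e0 m) = -y := by
    intro y hy hpos
    have hye : ip y (e0 m) = - y 0 := by rw [ip_comm, ip_e0_left]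
    have hvv : ip (y + e0 m) (y + e0 m) = -2 * (1 + y 0) := by
      simp only [ip_add_left, ip_add_right, hy, ip_e0, hye, ip_comm (e0 m) y]; ring
    have hve : ip (y + e0 m) (e0 m) = -(1 + y 0) := by
      simp only [ip_add_left, ip_e0, hye]; ring
    obtain ⟨L, hL, hLx⟩ := reflection (y + e0 m) (by rw [hvv]; nlinarith)
    refine ⟨L, hL, ?_⟩
    rw [hLx, hvv, hve]
    have : -(2 * -(1 + y 0) / (-2 * (1 + y 0))) = -1 := by
      have : 1 + y 0 ≠ 0 := by positivity
      field_simp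
    rw [this]
    ext i; simp
  have h1 := ip_sum x hx
  rcases lt_trichotomy (x 0) 0 with h | h | h
  · obtain ⟨L, hL, h2⟩ := key ((-1 : ℝ) • x) (by rw [ip_smul_left, ip_smul_right, hx]; norm_num)
      (by simpa using h)
    exact ⟨L, hL, Or.inl (by simpa using h2)⟩
  · rw [h] at h1; norm_num at h1
  · obtain ⟨L, hL, h2⟩ := key x hx h
    exact ⟨L, hL, Or.inr h2⟩

lemma hfun_smul {n : ℕ} (S : Matrix (Fin n) (Fin n) ℝ) (r : ℝ) (x : Fin n → ℝ) :
    hfun S (r • x) = r ^ 2 * ip (opT S x) (opT S x) + r ^ 4 * (ip x (opT S x)) ^ 2 := by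
  simp only [hfun, opT_smul, ip_smul_left, ip_smul_right]; ring

lemma hfun_neg {n : ℕ} (S : Matrix (Fin n) (Fin n) ℝ) (x : Fin n → ℝ) :
    hfun S (-x) = hfun S x := by
  have := hfun_smul S (-1) x
  rw [neg_one_smul] at this
  rw [this, hfun]; ring

lemma frob_le_iff {m : ℕ} (S : Matrix (Fin (m+1)) (Fin (m+1)) ℝ) (hS : Sᵀ = S)
    {L L' : Matrix (Fin (m+1)) (Fin (m+1)) ℝ} (hL : IsLorentz L) (hL' : IsLorentz L') :
    frobNorm (Lᵀ * S * L) ≤ frobNorm (L'ᵀ * S * L') ↔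
      hfun S (L.mulVec (e0 m)) ≤ hfun S (L'.mulVec (e0 m)) := by
  unfold frobNorm
  have hnn : 0 ≤ trace ((L'ᵀ * S * L') * (L'ᵀ * S * L')ᵀ) := by
    simp only [trace, diag_apply, mul_apply, transpose_apply]
    exact Finset.sum_nonneg fun i _ => Finset.sum_nonneg fun j _ => mul_self_nonneg _
  rw [Real.sqrt_le_sqrt_iff hnn, trace_formula S hS hL, trace_formula S hS hL']
  constructor <;> intro h <;> linarith

lemma orbit_min {m : ℕ} (S : Matrix (Fin (m+1)) (Fin (m+1)) ℝ) (hS : Sᵀ = S) :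
    (∃ L₀ : Matrix (Fin (m+1)) (Fin (m+1)) ℝ, IsLorentz L₀ ∧
      ∀ L : Matrix (Fin (m+1)) (Fin (m+1)) ℝ, IsLorentz L →
        frobNorm (L₀ᵀ * S * L₀) ≤ frobNorm (Lᵀ * S * L)) ↔
    ∃ x : Fin (m+1) → ℝ, ip x x = -1 ∧ ∀ y, ip y y = -1 → hfun S x ≤ hfun S y := by
  constructor
  · rintro ⟨L₀, hL₀, h⟩
    refine ⟨L₀.mulVec (e0 m), by rw [ip_lorentz hL₀, ip_e0], fun y hy => ?_⟩
    obtain ⟨L, hL, h2⟩ := transitive y hy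
    have h3 := (frob_le_iff S hS hL₀ hL).1 (h L hL)
    rcases h2 with h2 | h2
    · rwa [h2] at h3
    · rwa [h2, hfun_neg] at h3
  · rintro ⟨x, hx, h⟩
    obtain ⟨L₀, hL₀, h2⟩ := transitive x hx
    refine ⟨L₀, hL₀, fun L hL => (frob_le_iff S hS hL₀ hL).2 ?_⟩
    have h3 := h (L.mulVec (e0 m)) (by rw [ip_lorentz hL, ip_e0])
    rcases h2 with h2 | h2
    · rwa [h2]
    · rwa [h2, hfun_neg]

/-- On the hyperboloid, `hfun` is a nonnegative squared length. -/
lemma hfun_eq {n : ℕ} (S : Matrix (Fin n) (Fin n) ℝ) (x : Fin n → ℝ) (hx : ip x x = -1) :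
    ip x (opT S x + ip x (opT S x) • x) = 0 ∧
    ip (opT S x + ip x (opT S x) • x) (opT S x + ip x (opT S x) • x) = hfun S x := by
  simp only [ip_add_left, ip_add_right, ip_smul_left, ip_smul_right, hx, hfun,
    ip_comm (opT S x) x]
  constructor <;> ring

lemma ne_zero_of_ip {n : ℕ} {x : Fin n → ℝ} (hx : ip x x = -1) : x ≠ 0 := by
  rintro rfl
  simp [ip] at hx

lemma hfun_nonneg {m : ℕ} (S : Matrix (Fin (m+1)) (Fin (m+1)) ℝ) (x : Fin (m+1) → ℝ)
    (hx : ip x x = -1) : 0 ≤ hfun S x := by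
  obtain ⟨h1, h2⟩ := hfun_eq S x hx
  rw [← h2]
  exact (ip_orth x _ (ne_zero_of_ip hx) (by linarith) h1).1

lemma min_imp {m : ℕ} (S : Matrix (Fin (m+1)) (Fin (m+1)) ℝ) (hS : Sᵀ = S)
    (x : Fin (m+1) → ℝ) (hx : ip x x = -1) (hmin : ∀ y, ip y y = -1 → hfun S x ≤ hfun S y)
    (l0 : Fin (m+1) → ℝ) (hl0 : l0 ≠ 0) (hl0n : ip l0 l0 = 0) (c : ℝ) (hc0 : opT S l0 = c • l0) :
    ∃ l' : Fin (m+1) → ℝ, l' ≠ 0 ∧ ip l' l' = 0 ∧ opT S l' = c • l' ∧ ¬ ∃ t : ℝ, l' = t • l0 := by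
  have hx0 := ne_zero_of_ip hx
  have hs : ip x l0 ≠ 0 := by
    intro h
    obtain ⟨d, hd⟩ := (ip_orth x l0 hx0 (by linarith) h).2 hl0n.le
    rw [hd, ip_smul_right, hx] at h
    have : d = 0 := by linarith
    exact hl0 (by rw [hd, this, zero_smul])
  set s := ip x l0 with hsdef
  set l := (-s⁻¹) • l0 with hl
  have hxl : ip x l = -1 := by
    rw [hl, ip_smul_right, ← hsdef]; field_simp
  have hll : ip l l = 0 := by rw [hl, ip_smul_left, ip_smul_right, hl0n]; ring
  have hc : opT S l = c • l := by rw [hl, opT_smul, hc0, smul_comm]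
  have hlx : ip l x = -1 := by rw [ip_comm, hxl]
  set b := ip x (opT S x) with hb
  set A := ip (opT S x) (opT S x) with hA
  have hTl : ip (opT S x) l = -c := by
    rw [opT_symm S hS, hc, ip_smul_right, hxl]; ring
  have hlT : ip l (opT S x) = -c := by rw [ip_comm, hTl]
  have hnn := hfun_nonneg S x hx
  have hhx : hfun S x = A + b ^ 2 := rfl
  -- variation point
  have hy : ip (x + l) (x + l) = -3 := by
    simp only [ip_add_left, ip_add_right, hx, hxl, hlx, hll]; norm_num
  have hyr : ip ((√3)⁻¹ • (x + l)) ((√3)⁻¹ • (x + l)) = -1 := by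
    rw [ip_smul_left, ip_smul_right, hy]
    have h3 : √3 * √3 = 3 := Real.mul_self_sqrt (by norm_num)
    have h0 : √3 ≠ 0 := by positivity
    field_simp
    nlinarith
  have hm := hmin _ hyr
  rw [hfun_smul] at hm
  have e1 : ip (opT S (x + l)) (opT S (x + l)) = A - 2 * c ^ 2 := by
    rw [opT_add, hc]
    simp only [ip_add_left, ip_add_right, ip_smul_left, ip_smul_right, hTl, hlT, hll]
    ring
  have e2 : ip (x + l) (opT S (x + l)) = b - 2 * c := by
    rw [opT_add, hc]
    simp only [ip_add_left, ip_add_right, ip_smul_right, hlT, hll, hxl]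
    ring
  have r2 : ((√3)⁻¹) ^ 2 = 1 / 3 := by
    rw [inv_pow, Real.sq_sqrt (by norm_num)]; norm_num
  have r4 : ((√3)⁻¹) ^ 4 = 1 / 9 := by
    have : ((√3)⁻¹) ^ 4 = (((√3)⁻¹) ^ 2) ^ 2 := by ring
    rw [this, r2]; norm_num
  rw [e1, e2, r2, r4, hhx] at hm
  rw [hhx] at hnn
  have hz : A + b ^ 2 = 0 := by nlinarith [sq_nonneg (c + b)]
  have hcb : c = -b := by
    have : (c + b) ^ 2 ≤ 0 := by nlinarith
    have := pow_eq_zero_iff (two_ne_zero) |>.1 (le_antisymm this (sq_nonneg _))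
    linarith
  obtain ⟨q1, q2⟩ := hfun_eq S x hx
  rw [hhx, hz] at q2
  obtain ⟨d, hd⟩ := (ip_orth x _ hx0 (by linarith) q1).2 q2.le
  rw [hd, ip_smul_right, hx] at q1
  have hd0 : d = 0 := by linarith
  rw [hd0, zero_smul, ← hb] at hd
  have hTx : opT S x = c • x := by
    rw [hcb, neg_smul]; exact eq_neg_of_add_eq_zero_left hd
  have hnot : ∀ t : ℝ, (2:ℝ) • x + (-1 : ℝ) • l ≠ t • l := by
    intro t ht
    have h2x : (2:ℝ) • x = (t + 1) • l := by
      rw [add_smul, ← ht]; simp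
    have : ip ((2:ℝ) • x) ((2:ℝ) • x) = 0 := by
      rw [h2x, ip_smul_left, ip_smul_right, hll]; ring
    rw [ip_smul_left, ip_smul_right, hx] at this
    norm_num at this
  refine ⟨(2:ℝ) • x + (-1 : ℝ) • l, ?_, ?_, ?_, ?_⟩
  · intro h
    exact hnot 0 (by rw [h, zero_smul])
  · simp only [ip_add_left, ip_add_right, ip_smul_left, ip_smul_right, hx, hxl, hlx, hll]; norm_num
  · rw [opT_add, opT_smul, opT_smul, hTx, hc, smul_add, smul_comm c (2:ℝ), smul_comm c (-1:ℝ)]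
  · rintro ⟨t, ht⟩
    apply hnot (-(t * s))
    rw [ht, hl, smul_smul]
    congr 1
    field_simp

lemma two_null {m : ℕ} (S : Matrix (Fin (m+1)) (Fin (m+1)) ℝ) (hS : Sᵀ = S)
    (l l' : Fin (m+1) → ℝ) (hl0 : l ≠ 0) (hl : ip l l = 0) (hl' : ip l' l' = 0)
    (c c' : ℝ) (hc : opT S l = c • l) (hc' : opT S l' = c' • l') (hne : ¬ ∃ t : ℝ, l' = t • l) :
    ∃ x : Fin (m+1) → ℝ, ip x x = -1 ∧ ∀ y, ip y y = -1 → hfun S x ≤ hfun S y := by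
  have hs : ip l l' ≠ 0 := fun h => hne ((ip_orth l l' hl0 hl.le h).2 hl'.le)
  have hcc : c = c' := by
    have := opT_symm S hS l l'
    rw [hc, hc', ip_smul_left, ip_smul_right] at this
    exact mul_right_cancel₀ hs this
  subst hcc
  set s := ip l l' with hsd
  set x := l + (-(1 / (2 * s))) • l' with hxd
  have hx : ip x x = -1 := by
    simp only [hxd, ip_add_left, ip_add_right, ip_smul_left, ip_smul_right, hl, hl',
      ip_comm l' l, ← hsd]
    field_simp
    ring
  have hTx : opT S x = c • x := by
    rw [hxd, opT_add, opT_smul, hc, hc', smul_add, smul_comm c]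
  have h0 : hfun S x = 0 := by
    simp only [hfun, hTx, ip_smul_left, ip_smul_right, hx]; ring
  exact ⟨x, hx, fun y hy => h0 ▸ hfun_nonneg S y hy⟩

lemma continuous_ip {n : ℕ} {f g : (Fin n → ℝ) → (Fin n → ℝ)} (hf : Continuous f)
    (hg : Continuous g) : Continuous fun x => ip (f x) (g x) := by
  unfold ip
  exact hf.dotProduct (continuous_const.matrix_mulVec hg)

lemma continuous_opT {n : ℕ} (S : Matrix (Fin n) (Fin n) ℝ) : Continuous (opT S) :=
  continuous_const.matrix_mulVec (continuous_const.matrix_mulVec continuous_id)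

lemma coord_bound {m : ℕ} (x : Fin (m+1) → ℝ) (hx : ip x x ≤ 0) (i : Fin (m+1)) :
    |x i| ≤ |x 0| := by
  refine Fin.cases le_rfl (fun j => ?_) i
  rw [ip_eq] at hx
  have : x j.succ * x j.succ ≤ ∑ i : Fin m, x i.succ * x i.succ :=
    Finset.single_le_sum (f := fun i : Fin m => x i.succ * x i.succ)
      (fun i _ => mul_self_nonneg _) (Finset.mem_univ j)
  exact sq_le_sq.1 (by nlinarith)

lemma coercive {m : ℕ} (S : Matrix (Fin (m+1)) (Fin (m+1)) ℝ)
    (hno : ∀ l : Fin (m+1) → ℝ, l ≠ 0 → ip l l = 0 → ¬ ∃ c : ℝ, opT S l = c • l) (C : ℝ) :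
    ∃ M : ℕ, ∀ x : Fin (m+1) → ℝ, ip x x = -1 → (M : ℝ) < |x 0| → C ≤ hfun S x := by
  by_contra! hcon
  choose x hx hxM hxC using hcon
  have hK : IsCompact (Set.pi Set.univ fun _ : Fin (m+1) => Set.Icc (-1:ℝ) 1) :=
    isCompact_univ_pi fun _ => isCompact_Icc
  have hne : ∀ k, x k 0 ≠ 0 := by
    intro k h
    have := ip_sum _ (hx k)
    rw [h] at this; norm_num at this
  set y : ℕ → Fin (m+1) → ℝ := fun k => (x k 0)⁻¹ • x k with hy
  have hymem : ∀ k, y k ∈ Set.pi Set.univ fun _ : Fin (m+1) => Set.Icc (-1:ℝ) 1 := by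
    intro k i _
    have h1 := coord_bound (x k) (by rw [hx k]; norm_num) i
    have : |y k i| ≤ 1 := by
      simp only [hy, Pi.smul_apply, smul_eq_mul, abs_mul, abs_inv]
      rw [inv_mul_le_iff₀ (abs_pos.2 (hne k)), mul_one]
      exact h1
    exact abs_le.1 this
  obtain ⟨z, _, φ, hφ, hlim⟩ := hK.tendsto_subseq hymem
  have hr : Filter.Tendsto (fun k => ((x (φ k) 0)⁻¹) ^ 2) Filter.atTop (nhds 0) := by
    have h1 : Filter.Tendsto (fun k => |x (φ k) 0|) Filter.atTop Filter.atTop := by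
      refine Filter.tendsto_atTop_mono (fun k => ?_)
        (tendsto_natCast_atTop_atTop (R := ℝ))
      have h2 : (k : ℝ) ≤ φ k := by exact_mod_cast hφ.id_le k
      exact h2.trans (hxM (φ k)).le
    have h2 := (tendsto_inv_atTop_zero.comp h1).pow 2
    simpa [Function.comp_def, inv_pow, sq_abs] using h2
  have hcont : ∀ F : (Fin (m+1) → ℝ) → ℝ, Continuous F →
      Filter.Tendsto (fun k => F (y (φ k))) Filter.atTop (nhds (F z)) :=
    fun F hF => (hF.tendsto z).comp hlim
  have hz0 : z 0 = 1 := by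
    have h1 := hcont (fun v => v 0) (continuous_apply 0)
    have h2 : (fun k => y (φ k) 0) = fun _ => (1:ℝ) := by
      funext k
      simp [hy, hne]
    rw [h2] at h1
    exact tendsto_nhds_unique h1 tendsto_const_nhds
  have hzz : ip z z = 0 := by
    have h1 := hcont (fun v => ip v v) (continuous_ip continuous_id continuous_id)
    have h2 : (fun k => ip (y (φ k)) (y (φ k))) = fun k => - ((x (φ k) 0)⁻¹) ^ 2 := by
      funext k
      simp only [hy, ip_smul_left, ip_smul_right, hx]; ring
    rw [h2] at h1
    have h3 := hr.neg
    rw [neg_zero] at h3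
    exact tendsto_nhds_unique h1 h3
  -- the key inequality
  have hkey : ∀ k, ((x k 0)⁻¹) ^ 2 * ip (opT S (y k)) (opT S (y k)) + (ip (y k) (opT S (y k))) ^ 2
      ≤ C * (((x k 0)⁻¹) ^ 2) ^ 2 := by
    intro k
    have h1 : hfun S (x k) = (x k 0) ^ 2 * ip (opT S (y k)) (opT S (y k))
        + (x k 0) ^ 4 * (ip (y k) (opT S (y k))) ^ 2 := by
      have h2 : x k = (x k 0) • y k := by
        simp [hy, smul_smul, hne]
      calc hfun S (x k) = hfun S ((x k 0) • y k) := by rw [← h2]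
        _ = _ := hfun_smul _ _ _
    have h3 := (hxC k).le
    rw [h1] at h3
    have h4 := mul_le_mul_of_nonneg_right h3 (sq_nonneg (((x k 0)⁻¹) ^ 2))
    have h5 := hne k
    refine le_trans (le_of_eq ?_) h4
    field_simp
  have hA := hcont (fun v => ip (opT S v) (opT S v))
    (continuous_ip (continuous_opT S) (continuous_opT S))
  have hB := hcont (fun v => ip v (opT S v)) (continuous_ip continuous_id (continuous_opT S))
  have hBz : ip z (opT S z) = 0 := by
    have h1 := le_of_tendsto_of_tendsto' ((hr.mul hA).add (hB.pow 2)) ((hr.pow 2).const_mul C)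
      (fun k => hkey (φ k))
    have : (ip z (opT S z)) ^ 2 ≤ 0 := by simpa using h1
    exact pow_eq_zero_iff two_ne_zero |>.1 (le_antisymm this (sq_nonneg _))
  have hAz : ip (opT S z) (opT S z) ≤ 0 := by
    have h1 := le_of_tendsto_of_tendsto' hA (hr.const_mul C) (fun k => by
      have h2 := hkey (φ k)
      have hp : 0 < ((x (φ k) 0)⁻¹) ^ 2 := by
        have := hne (φ k)
        positivity
      have h3 := sq_nonneg (ip (y (φ k)) (opT S (y (φ k))))
      by_contra! h4
      have h5 := mul_lt_mul_of_pos_left h4 hp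
      nlinarith)
    simpa using h1
  have hzne : z ≠ 0 := by
    intro h; rw [h] at hz0; simp at hz0
  exact hno z hzne hzz ((ip_orth z _ hzne hzz.le hBz).2 hAz)

lemma no_null {m : ℕ} (S : Matrix (Fin (m+1)) (Fin (m+1)) ℝ)
    (hno : ∀ l : Fin (m+1) → ℝ, l ≠ 0 → ip l l = 0 → ¬ ∃ c : ℝ, opT S l = c • l) :
    ∃ x : Fin (m+1) → ℝ, ip x x = -1 ∧ ∀ y, ip y y = -1 → hfun S x ≤ hfun S y := by
  obtain ⟨M, hM⟩ := coercive S hno (hfun S (e0 m))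
  set R : ℝ := (M : ℝ) + 1
  have hK : IsCompact ((Set.pi Set.univ fun _ : Fin (m+1) => Set.Icc (-R) R) ∩
      {x | ip x x = -1}) :=
    (isCompact_univ_pi fun _ => isCompact_Icc).inter_right
      (isClosed_eq (continuous_ip continuous_id continuous_id) continuous_const)
  have hmem : ∀ y : Fin (m+1) → ℝ, ip y y = -1 → |y 0| ≤ R →
      y ∈ (Set.pi Set.univ fun _ : Fin (m+1) => Set.Icc (-R) R) ∩ {x | ip x x = -1} := by
    intro y hy h
    exact ⟨fun i _ => abs_le.1 ((coord_bound y (by linarith) i).trans h), hy⟩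
  have he := hmem (e0 m) (ip_e0 m) (by simp [e0, R])
  have hcont : Continuous (hfun S) :=
    (continuous_ip (continuous_opT S) (continuous_opT S)).add
      ((continuous_ip continuous_id (continuous_opT S)).pow 2)
  obtain ⟨x, hxm, hxmin⟩ := hK.exists_isMinOn ⟨_, he⟩ hcont.continuousOn
  refine ⟨x, hxm.2, fun y hy => ?_⟩
  by_cases h : |y 0| ≤ R
  · exact hxmin (hmem y hy h)
  · have h1 : (M : ℝ) < |y 0| := by simp only [R] at h; linarith
    exact le_trans (hxmin he) (hM y hy h1)

/-- Alignment theorem for symmetric rank-2 tensors: the Lorentz orbit of a symmetric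
matrix `S` contains an element of minimal Frobenius norm iff the Ricci operator `ηS`
does not have exactly one null eigendirection. -/
theorem stmt17 {n : ℕ} (hn : 2 ≤ n)
    (S : Matrix (Fin n) (Fin n) ℝ) (hS : Sᵀ = S) :
    (∃ Λ₀ : Matrix (Fin n) (Fin n) ℝ, IsLorentz Λ₀ ∧
      ∀ Λ : Matrix (Fin n) (Fin n) ℝ, IsLorentz Λ →
        frobNorm (Λ₀ᵀ * S * Λ₀) ≤ frobNorm (Λᵀ * S * Λ)) ↔
    ¬ (∃ l : Fin n → ℝ, IsNull l ∧
        (∃ c : ℝ, S.mulVec l = c • ((eta n).mulVec l)) ∧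
        ∀ l' : Fin n → ℝ, IsNull l' →
          (∃ c : ℝ, S.mulVec l' = c • ((eta n).mulVec l')) →
          ∃ t : ℝ, l' = t • l) := by
  obtain ⟨m, rfl⟩ : ∃ m, n = m + 1 := ⟨n - 1, by omega⟩
  rw [orbit_min S hS]
  simp only [eig_iff]
  constructor
  · rintro ⟨x, hx, hmin⟩ ⟨l, ⟨hl0, hln⟩, ⟨c, hc⟩, huniq⟩
    obtain ⟨l', h1, h2, h3, h4⟩ := min_imp S hS x hx hmin l hl0 hln c hc
    exact h4 (huniq l' ⟨h1, h2⟩ ⟨c, h3⟩)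
  · intro hnot
    by_cases hno : ∀ l : Fin (m+1) → ℝ, l ≠ 0 → ip l l = 0 → ¬ ∃ c : ℝ, opT S l = c • l
    · exact no_null S hno
    · push Not at hno
      obtain ⟨l, hl0, hl, c, hc⟩ := hno
      by_contra hcon
      apply hnot
      refine ⟨l, ⟨hl0, hl⟩, ⟨c, hc⟩, fun l' hl' hc' => ?_⟩
      obtain ⟨c', hc'⟩ := hc'
      by_contra hne
      exact hcon (two_null S hS l l' hl0 hl hl'.2 c c' hc hc' hne)

end
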